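/- arXiv:math/0411399 — 2 statements merged into one kernel-verified Lean document; each statement's English description precedes it below -/
import Mathlib

section
/- In the graded polynomial ring R = 𝔽₂[W₁, W₂, W₃, …] with deg W_i = i, write W^{(N)} = 1 + Σ_{i=1}^{N} W_i. Then the weight-8 homogeneous component of W^{(8)}·(W̄₁ + W̄₂)·(W̄₀ + W̄₁) + W^{(8)}·(C(2,0)·W̄₁ + C(2,1)·W̄₂ + C(2,2)·W̄₃) equals W₆·W₂ + W₅·(W₃ + W₁·W₂), where C(2,j) denotes the binomial coefficient reduced mod 2 (so C(2,1)·W̄₂ = 0 in R). -/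
open MvPolynomial Finset

/-- The variable `W_i` (for `i` a positive integer) in the graded polynomial ring
`𝔽₂[W₁, W₂, W₃, …]`. -/
noncomputable def Wv (i : ℕ+) : MvPolynomial ℕ+ (ZMod 2) := X i

/-- The weight of a variable: `W_i` has weight `i`. -/
def wWt : ℕ+ → ℕ := fun i => (i : ℕ)

/-- The dual classes `W̄_j`, defined by `W̄₀ = 1` and
`W̄_j = Σ_{i=1}^{j} W_i · W̄_{j-i}` for `j ≥ 1`. -/
noncomputable def Wbar : ℕ → MvPolynomial ℕ+ (ZMod 2)
  | 0 => 1
  | j + 1 => ∑ i ∈ Finset.range (j + 1), Wv ⟨i + 1, Nat.succ_pos i⟩ * Wbar (j - i)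
  termination_by j => j
  decreasing_by omega

/-- The truncated total class `W^{(N)} = 1 + Σ_{i=1}^{N} W_i`. -/
noncomputable def Wtot (N : ℕ) : MvPolynomial ℕ+ (ZMod 2) :=
  1 + ∑ i ∈ Finset.range N, Wv ⟨i + 1, Nat.succ_pos i⟩

theorem isWeightedHomogeneous_Wv (i : ℕ+) : IsWeightedHomogeneous wWt (Wv i) (i : ℕ) :=
  isWeightedHomogeneous_X _ _ _

/-- Multiplying a class of weight `k` by the total class, the component of weight `i + 1 + k`
is the product with `W_{i+1}`. -/
theorem weightedHomogeneousComponent_Wtot_mul {N i k : ℕ} (hi : i < N)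
    {p : MvPolynomial ℕ+ (ZMod 2)} (hp : IsWeightedHomogeneous wWt p k) :
    weightedHomogeneousComponent wWt (i + 1 + k) (Wtot N * p) =
      Wv ⟨i + 1, Nat.succ_pos i⟩ * p := by
  have hterm (j : ℕ) : IsWeightedHomogeneous wWt (Wv ⟨j + 1, Nat.succ_pos j⟩ * p) (j + 1 + k) :=
    (isWeightedHomogeneous_Wv _).mul hp
  rw [Wtot, add_mul, one_mul, Finset.sum_mul, map_add, map_sum,
    hp.weightedHomogeneousComponent_ne _ (by omega), zero_add,
    Finset.sum_eq_single_of_mem i (Finset.mem_range.2 hi)]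
  · exact (hterm i).weightedHomogeneousComponent_same
  · intro j _ hj
    exact (hterm j).weightedHomogeneousComponent_ne _ (by omega)

theorem Wbar_zero : Wbar 0 = 1 := by
  rw [Wbar]

theorem Wbar_one : Wbar 1 = Wv 1 := by
  rw [Wbar, Finset.sum_range_one, Wbar_zero, mul_one]
  rfl

theorem Wbar_two : Wbar 2 = Wv 1 * Wv 1 + Wv 2 := by
  rw [Wbar, Finset.sum_range_succ, Finset.sum_range_one, Wbar_one, Wbar_zero, mul_one]
  rfl

theorem Wbar_three : Wbar 3 = Wv 1 * (Wv 1 * Wv 1 + Wv 2) + Wv 2 * Wv 1 + Wv 3 := by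
  rw [Wbar, Finset.sum_range_succ, Finset.sum_range_succ, Finset.sum_range_one, Wbar_two,
    Wbar_one, Wbar_zero, mul_one]
  rfl

/-- the weight-8 homogeneous component of
`W⁽⁸⁾·(W̄₁ + W̄₂)·(W̄₀ + W̄₁) + W⁽⁸⁾·(C(2,0)·W̄₁ + C(2,1)·W̄₂ + C(2,2)·W̄₃)`
equals `W₆·W₂ + W₅·(W₃ + W₁·W₂)`, where the binomial coefficients are reduced mod 2. -/
theorem statement9 :
    weightedHomogeneousComponent wWt 8
      (Wtot 8 * (Wbar 1 + Wbar 2) * (Wbar 0 + Wbar 1) +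
        Wtot 8 * ((Nat.choose 2 0 : MvPolynomial ℕ+ (ZMod 2)) * Wbar 1 +
          (Nat.choose 2 1 : MvPolynomial ℕ+ (ZMod 2)) * Wbar 2 +
          (Nat.choose 2 2 : MvPolynomial ℕ+ (ZMod 2)) * Wbar 3)) =
      Wv 6 * Wv 2 + Wv 5 * (Wv 3 + Wv 1 * Wv 2) := by
  have h2 : (2 : MvPolynomial ℕ+ (ZMod 2)) = 0 := CharTwo.two_eq_zero
  have hsum : Wtot 8 * (Wbar 1 + Wbar 2) * (Wbar 0 + Wbar 1) +
        Wtot 8 * ((Nat.choose 2 0 : MvPolynomial ℕ+ (ZMod 2)) * Wbar 1 +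
          (Nat.choose 2 1 : MvPolynomial ℕ+ (ZMod 2)) * Wbar 2 +
          (Nat.choose 2 2 : MvPolynomial ℕ+ (ZMod 2)) * Wbar 3) =
      Wtot 8 * Wv 2 + Wtot 8 * (Wv 3 + Wv 1 * Wv 2) := by
    simp only [Nat.choose_zero_right, Nat.choose_one_right, Nat.choose_self, Nat.cast_one,
      Nat.cast_ofNat, Wbar_zero, Wbar_one, Wbar_two, Wbar_three]
    linear_combination
      Wtot 8 * (Wv 1 + 2 * Wv 1 ^ 2 + Wv 1 ^ 3 + Wv 1 * Wv 2 + Wv 2) * h2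
  have h₃ : IsWeightedHomogeneous wWt (Wv 3 + Wv 1 * Wv 2) 3 :=
    (isWeightedHomogeneous_Wv 3).add
      ((isWeightedHomogeneous_Wv 1).mul (isWeightedHomogeneous_Wv 2))
  have h₆ : weightedHomogeneousComponent wWt 8 (Wtot 8 * Wv 2) = Wv 6 * Wv 2 :=
    weightedHomogeneousComponent_Wtot_mul (i := 5) (k := 2) (by norm_num)
      (isWeightedHomogeneous_Wv 2)
  have h₅ : weightedHomogeneousComponent wWt 8 (Wtot 8 * (Wv 3 + Wv 1 * Wv 2)) =
      Wv 5 * (Wv 3 + Wv 1 * Wv 2) :=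
    weightedHomogeneousComponent_Wtot_mul (i := 4) (k := 3) (by norm_num) h₃
  rw [hsum, map_add, h₆, h₅]
end

section
/- Let A be the quotient ring 𝔽₂[a, b]/(a⁷, b³). For j ≥ 0 let w_j ∈ A be the image in A of the total-degree-j homogeneous component of the polynomial (1 + a)⁷·(1 + b)³ ∈ 𝔽₂[a, b] (with deg a = deg b = 1). Then w₆·w₂ + w₅·(w₃ + w₁·w₂) = a⁶b² in A, and a⁶b² ≠ 0 in A. -/
open MvPolynomial

/-- The ideal `(a⁷, b³)` in `𝔽₂[a, b]`, where `a = X 0` and `b = X 1`. -/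
noncomputable def projIdeal : Ideal (MvPolynomial (Fin 2) (ZMod 2)) :=
  Ideal.span {(X 0 : MvPolynomial (Fin 2) (ZMod 2)) ^ 7, (X 1 : MvPolynomial (Fin 2) (ZMod 2)) ^ 3}

/-- `w_j` : the image in `𝔽₂[a,b]/(a⁷, b³)` of the total-degree-`j` homogeneous
component of `(1 + a)⁷·(1 + b)³`. -/
noncomputable def wClass (j : ℕ) : MvPolynomial (Fin 2) (ZMod 2) ⧸ projIdeal :=
  Ideal.Quotient.mk projIdeal
    (homogeneousComponent j ((1 + X 0) ^ 7 * (1 + X 1) ^ 3))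

theorem homogeneousComponent_X_pow_mul_X_pow {σ R : Type*} [CommSemiring R]
    (s t : σ) (n i j : ℕ) :
    homogeneousComponent n ((X s : MvPolynomial σ R) ^ i * X t ^ j) =
      if n = i + j then X s ^ i * X t ^ j else 0 := by
  have h : (X s ^ i * X t ^ j : MvPolynomial σ R).IsHomogeneous (i + j) :=
    (isHomogeneous_X_pow s i).mul (isHomogeneous_X_pow t j)
  rw [homogeneousComponent_of_mem h]

theorem one_add_pow_seven_of_charTwo {R : Type*} [CommRing R] [CharP R 2] (x : R) :
    (1 + x) ^ 7 = ∑ i ∈ Finset.range 8, x ^ i := by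
  simp only [Finset.sum_range_succ, Finset.sum_range_zero]
  linear_combination (3 * x + 10 * x ^ 2 + 17 * x ^ 3 + 17 * x ^ 4 + 10 * x ^ 5 + 3 * x ^ 6) *
    CharTwo.two_eq_zero (R := R)

theorem one_add_pow_three_of_charTwo {R : Type*} [CommRing R] [CharP R 2] (x : R) :
    (1 + x) ^ 3 = ∑ i ∈ Finset.range 4, x ^ i := by
  simp only [Finset.sum_range_succ, Finset.sum_range_zero]
  linear_combination (x + x ^ 2) * CharTwo.two_eq_zero (R := R)

theorem wClass_eq_sum (n : ℕ) :
    wClass n = ∑ i ∈ Finset.range 8, ∑ j ∈ Finset.range 4,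
      if n = i + j then
        Ideal.Quotient.mk projIdeal (X 0) ^ i * Ideal.Quotient.mk projIdeal (X 1) ^ j
      else 0 := by
  simp only [wClass, one_add_pow_seven_of_charTwo, one_add_pow_three_of_charTwo,
    Finset.sum_mul_sum, map_sum, homogeneousComponent_X_pow_mul_X_pow, apply_ite, map_mul,
    map_pow, map_zero]

theorem X_pow_mul_X_pow_notMem_span {σ R : Type*} [CommRing R] [Nontrivial R]
    {s t : σ} (hst : s ≠ t) {m n i j : ℕ} (hi : i < m) (hj : j < n) :
    (X s : MvPolynomial σ R) ^ i * X t ^ j ∉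
      Ideal.span {(X s : MvPolynomial σ R) ^ m, X t ^ n} := by
  classical
  intro h
  obtain ⟨p, q, h⟩ := Ideal.mem_span_pair.mp h
  replace h := congrArg (coeff (Finsupp.single s i + Finsupp.single t j)) h
  simp [X_pow_eq_monomial, monomial_mul, coeff_mul_monomial', Finsupp.single_le_iff,
    hst, hst.symm, hi.not_ge, hj.not_ge] at h

/-- in `A = 𝔽₂[a, b]/(a⁷, b³)`, with `w_j` the degree-`j` component of
`(1+a)⁷(1+b)³`, we have `w₆w₂ + w₅(w₃ + w₁w₂) = a⁶b²` and `a⁶b² ≠ 0`. -/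
theorem statement11 :
    wClass 6 * wClass 2 + wClass 5 * (wClass 3 + wClass 1 * wClass 2) =
      Ideal.Quotient.mk projIdeal ((X 0 : MvPolynomial (Fin 2) (ZMod 2)) ^ 6 * X 1 ^ 2) ∧
    Ideal.Quotient.mk projIdeal ((X 0 : MvPolynomial (Fin 2) (ZMod 2)) ^ 6 * X 1 ^ 2) ≠ 0 := by
  refine ⟨?_, fun h => X_pow_mul_X_pow_notMem_span (by decide) (by norm_num) (by norm_num)
    (Ideal.Quotient.eq_zero_iff_mem.mp h)⟩
  have ha : Ideal.Quotient.mk projIdeal (X 0) ^ 7 = 0 := by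
    rw [← map_pow]
    exact Ideal.Quotient.eq_zero_iff_mem.mpr (Ideal.subset_span (by simp))
  have hb : Ideal.Quotient.mk projIdeal (X 1) ^ 3 = 0 := by
    rw [← map_pow]
    exact Ideal.Quotient.eq_zero_iff_mem.mpr (Ideal.subset_span (by simp))
  have h2 : (2 : MvPolynomial (Fin 2) (ZMod 2) ⧸ projIdeal) = 0 := by
    have h := congrArg (Ideal.Quotient.mk projIdeal)
      (CharTwo.two_eq_zero (R := MvPolynomial (Fin 2) (ZMod 2)))
    rwa [map_zero] at h
  simp only [wClass_eq_sum, map_mul, map_pow]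
  generalize Ideal.Quotient.mk projIdeal (X 0) = a at *
  generalize Ideal.Quotient.mk projIdeal (X 1) = b at *
  simp [Finset.sum_range_succ, hb]
  linear_combination (7 * b + 3 * a) * ha +
    (a ^ 3 * b ^ 2 + 5 * a ^ 4 * b + 9 * a ^ 5) * hb + 5 * a ^ 6 * b ^ 2 * h2
end
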